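/- A lightcone framed curve (γ,ℓ⁺,ℓ⁻) : I → ℝ³₁ × Δ₄ with lightcone curvature (κ₁,κ₂,κ₃,α,β) is an (ℓ̃⁻,ℓ̄⁻)-Bertrand lightcone framed curve if and only if there exist smooth functions λ, k : I → ℝ with λ ≢ 0 such that k(t)(α(t)+β(t)) − α(t) + β(t) − λ(t)(κ₁(t)−κ₂(t)+κ₃(t)) = 0 for all t ∈ I; consequently, (γ,ℓ⁺,ℓ⁻) is an (ℓ̃⁻,ℓ̄⁺)-Bertrand lightcone framed curve if and only if it is an (ℓ̃⁻,ℓ̄⁻)-Bertrand lightcone framed curve. -/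

import Mathlib

open Matrix

noncomputable section

/-- The Minkowski pseudo-scalar product on `ℝ³`:
`⟨x,y⟩ = −x₁y₁ + x₂y₂ + x₃y₃`. -/
def mdot (x y : Fin 3 → ℝ) : ℝ := -(x 0 * y 0) + x 1 * y 1 + x 2 * y 2

/-- The pseudo vector product `x ∧ y` on Minkowski `ℝ³`, i.e. the determinant of the
matrix with rows `(−e₁, e₂, e₃)`, `x`, `y`. -/
def mcross (x y : Fin 3 → ℝ) : Fin 3 → ℝ :=
  ![-(x 1 * y 2 - x 2 * y 1), x 2 * y 0 - x 0 * y 2, x 0 * y 1 - x 1 * y 0]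

/-- The (punctured) lightcone `LC* = {x ≠ 0 : ⟨x,x⟩ = 0}`. -/
def LCstar (x : Fin 3 → ℝ) : Prop := x ≠ 0 ∧ mdot x x = 0

/-- Membership in `Δ₄ = {(v,w) ∈ LC* × LC* : ⟨v,w⟩ = −2}`. -/
def MemDelta4 (v w : Fin 3 → ℝ) : Prop := LCstar v ∧ LCstar w ∧ mdot v w = -2

/-- `n(t) = −(1/2) ℓ⁺(t) ∧ ℓ⁻(t)`. -/
def lcn (lp lm : ℝ → Fin 3 → ℝ) : ℝ → Fin 3 → ℝ :=
  fun t => (-(1/2) : ℝ) • mcross (lp t) (lm t)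

/-- Smoothness (on `I`) of a real valued function. -/
def Smooth1 (I : Set ℝ) (f : ℝ → ℝ) : Prop := ContDiffOn ℝ (⊤ : ℕ∞) f I

/-- Smoothness (on `I`) of an `ℝ³`-valued function. -/
def Smooth3 (I : Set ℝ) (f : ℝ → Fin 3 → ℝ) : Prop := ContDiffOn ℝ (⊤ : ℕ∞) f I

/-- `λ ≢ 0` : the set where `λ` is non-zero is dense in `I`. -/
def NotIdentZero (I : Set ℝ) (f : ℝ → ℝ) : Prop :=
  I ⊆ closure {t | t ∈ I ∧ f t ≠ 0}

/-- A lightcone framed curve `(γ, ℓ⁺, ℓ⁻) : I → ℝ³₁ × Δ₄`. -/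
structure IsLightconeFramedCurve (I : Set ℝ) (γ lp lm : ℝ → Fin 3 → ℝ) : Prop where
  smooth_base : Smooth3 I γ
  smooth_lp : Smooth3 I lp
  smooth_lm : Smooth3 I lm
  delta4 : ∀ t ∈ I, MemDelta4 (lp t) (lm t)
  exists_coeffs : ∃ α β : ℝ → ℝ, Smooth1 I α ∧ Smooth1 I β ∧
    ∀ t ∈ I, deriv γ t = α t • lp t + β t • lm t

/-- `(κ₁, κ₂, κ₃, α, β)` is the lightcone curvature of the lightcone framed curve
`(γ, ℓ⁺, ℓ⁻)`. -/
structure HasLightconeCurvature (I : Set ℝ) (γ lp lm : ℝ → Fin 3 → ℝ)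
    (κ₁ κ₂ κ₃ α β : ℝ → ℝ) : Prop where
  smooth_κ₁ : Smooth1 I κ₁
  smooth_κ₂ : Smooth1 I κ₂
  smooth_κ₃ : Smooth1 I κ₃
  smooth_α : Smooth1 I α
  smooth_β : Smooth1 I β
  deriv_lp : ∀ t ∈ I, deriv lp t = κ₁ t • lp t + (2 * κ₃ t) • lcn lp lm t
  deriv_lm : ∀ t ∈ I, deriv lm t = (-κ₁ t) • lm t + (2 * κ₂ t) • lcn lp lm t
  deriv_n : ∀ t ∈ I, deriv (lcn lp lm) t = κ₂ t • lp t + κ₃ t • lm t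
  deriv_base : ∀ t ∈ I, deriv γ t = α t • lp t + β t • lm t

/-- The vector field `ℓ⁺` built from a lightcone frame. -/
def fieldLp (lp lm : ℝ → Fin 3 → ℝ) : ℝ → Fin 3 → ℝ := fun t => lp t
/-- The vector field `ℓ⁻` built from a lightcone frame. -/
def fieldLm (lp lm : ℝ → Fin 3 → ℝ) : ℝ → Fin 3 → ℝ := fun t => lm t
/-- `nᵀ = (ℓ⁺ + ℓ⁻)/2`. -/
def fieldNT (lp lm : ℝ → Fin 3 → ℝ) : ℝ → Fin 3 → ℝ := fun t => (1/2 : ℝ) • (lp t + lm t)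
/-- `nˢ = (ℓ⁺ − ℓ⁻)/2`. -/
def fieldNS (lp lm : ℝ → Fin 3 → ℝ) : ℝ → Fin 3 → ℝ := fun t => (1/2 : ℝ) • (lp t - lm t)
/-- `n = −(1/2) ℓ⁺ ∧ ℓ⁻`. -/
def fieldN (lp lm : ℝ → Fin 3 → ℝ) : ℝ → Fin 3 → ℝ := lcn lp lm
/-- `ℓ̃⁺ = nᵀ + n`. -/
def fieldLtp (lp lm : ℝ → Fin 3 → ℝ) : ℝ → Fin 3 → ℝ :=
  fun t => fieldNT lp lm t + fieldN lp lm t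
/-- `ℓ̃⁻ = nᵀ − n`. -/
def fieldLtm (lp lm : ℝ → Fin 3 → ℝ) : ℝ → Fin 3 → ℝ :=
  fun t => fieldNT lp lm t - fieldN lp lm t

/-- `(γ,ℓ⁺,ℓ⁻)` and `(γ̄,ℓ̄⁺,ℓ̄⁻)` are `(v,w̄)`-mates. -/
def AreMates (I : Set ℝ)
    (v w : (ℝ → Fin 3 → ℝ) → (ℝ → Fin 3 → ℝ) → ℝ → Fin 3 → ℝ)
    (γ lp lm γ' lp' lm' : ℝ → Fin 3 → ℝ) : Prop :=
  IsLightconeFramedCurve I γ lp lm ∧ IsLightconeFramedCurve I γ' lp' lm' ∧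
  ∃ lam : ℝ → ℝ, Smooth1 I lam ∧ NotIdentZero I lam ∧
    (∀ t ∈ I, γ' t = γ t + lam t • v lp lm t) ∧
    (∀ t ∈ I, v lp lm t = w lp' lm' t)

/-- `(γ,ℓ⁺,ℓ⁻)` is a `(v,w̄)`-Bertrand lightcone framed curve. -/
def IsBertrand (I : Set ℝ)
    (v w : (ℝ → Fin 3 → ℝ) → (ℝ → Fin 3 → ℝ) → ℝ → Fin 3 → ℝ)
    (γ lp lm : ℝ → Fin 3 → ℝ) : Prop :=
  ∃ γ' lp' lm' : ℝ → Fin 3 → ℝ, AreMates I v w γ lp lm γ' lp' lm'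

theorem mdot_comm (x y : Fin 3 → ℝ) : mdot x y = mdot y x := by
  simp only [mdot]; ring

theorem mdot_add_left (x y z : Fin 3 → ℝ) : mdot (x + y) z = mdot x z + mdot y z := by
  simp only [mdot, Pi.add_apply]; ring

theorem mdot_sub_left (x y z : Fin 3 → ℝ) : mdot (x - y) z = mdot x z - mdot y z := by
  simp only [mdot, Pi.sub_apply]; ring

theorem mdot_smul_left (c : ℝ) (x z : Fin 3 → ℝ) : mdot (c • x) z = c * mdot x z := by
  simp only [mdot, Pi.smul_apply, smul_eq_mul]; ring

theorem mdot_add_right (x y z : Fin 3 → ℝ) : mdot x (y + z) = mdot x y + mdot x z := by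
  simp only [mdot, Pi.add_apply]; ring

theorem mdot_sub_right (x y z : Fin 3 → ℝ) : mdot x (y - z) = mdot x y - mdot x z := by
  simp only [mdot, Pi.sub_apply]; ring

theorem mdot_smul_right (c : ℝ) (x z : Fin 3 → ℝ) : mdot x (c • z) = c * mdot x z := by
  simp only [mdot, Pi.smul_apply, smul_eq_mul]; ring

theorem mdot_mcross_left (x y : Fin 3 → ℝ) : mdot x (mcross x y) = 0 := by
  simp [mdot, mcross]; ring

theorem mdot_mcross_right (x y : Fin 3 → ℝ) : mdot y (mcross x y) = 0 := by
  simp [mdot, mcross]; ring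

theorem mdot_mcross_mcross (x y : Fin 3 → ℝ) :
    mdot (mcross x y) (mcross x y) = mdot x y ^ 2 - mdot x x * mdot y y := by
  simp [mdot, mcross]; ring

theorem memDelta4_of_mdot {v w : Fin 3 → ℝ} (hv : mdot v v = 0) (hw : mdot w w = 0)
    (hvw : mdot v w = -2) : MemDelta4 v w := by
  refine ⟨⟨?_, hv⟩, ⟨?_, hw⟩, hvw⟩ <;> rintro rfl <;> simp [mdot] at hvw

theorem MemDelta4.symm {v w : Fin 3 → ℝ} (h : MemDelta4 v w) : MemDelta4 w v :=
  ⟨h.2.1, h.1, by rw [mdot_comm]; exact h.2.2⟩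

/-- The Gram matrix of the moving frame `(ℓ⁺, ℓ⁻, n)`. -/
theorem mdot_frame {lp lm : ℝ → Fin 3 → ℝ} {t : ℝ} (h : MemDelta4 (lp t) (lm t)) :
    mdot (lp t) (lp t) = 0 ∧ mdot (lm t) (lm t) = 0 ∧ mdot (lp t) (lm t) = -2 ∧
      mdot (lm t) (lp t) = -2 ∧ mdot (lp t) (lcn lp lm t) = 0 ∧
      mdot (lm t) (lcn lp lm t) = 0 ∧ mdot (lcn lp lm t) (lp t) = 0 ∧
      mdot (lcn lp lm t) (lm t) = 0 ∧ mdot (lcn lp lm t) (lcn lp lm t) = 1 := by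
  obtain ⟨⟨-, h₁⟩, ⟨-, h₂⟩, h₃⟩ := h
  have h₄ : mdot (lp t) (lcn lp lm t) = 0 := by
    simp only [lcn, mdot_smul_right, mdot_mcross_left, mul_zero]
  have h₅ : mdot (lm t) (lcn lp lm t) = 0 := by
    simp only [lcn, mdot_smul_right, mdot_mcross_right, mul_zero]
  refine ⟨h₁, h₂, h₃, by rw [mdot_comm, h₃], h₄, h₅, by rw [mdot_comm, h₄],
    by rw [mdot_comm, h₅], ?_⟩
  simp only [lcn, mdot_smul_right, mdot_smul_left, mdot_mcross_mcross, h₁, h₂, h₃]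
  norm_num

theorem smooth3_lcn {I : Set ℝ} {lp lm : ℝ → Fin 3 → ℝ} (hp : Smooth3 I lp)
    (hm : Smooth3 I lm) : Smooth3 I (lcn lp lm) := by
  have p := fun i => (contDiffOn_pi (𝕜 := ℝ)).1 hp i
  have m := fun i => (contDiffOn_pi (𝕜 := ℝ)).1 hm i
  refine contDiffOn_pi.2 fun i => ?_
  fin_cases i
  · exact contDiffOn_const.mul (((p 1).mul (m 2)).sub ((p 2).mul (m 1))).neg
  · exact contDiffOn_const.mul (((p 2).mul (m 0)).sub ((p 0).mul (m 2)))
  · exact contDiffOn_const.mul (((p 0).mul (m 1)).sub ((p 1).mul (m 0)))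

theorem smooth3_fieldNT {I : Set ℝ} {lp lm : ℝ → Fin 3 → ℝ} (hp : Smooth3 I lp)
    (hm : Smooth3 I lm) : Smooth3 I (fieldNT lp lm) :=
  ContDiffOn.const_smul _ (ContDiffOn.add hp hm)

theorem smooth3_fieldNS {I : Set ℝ} {lp lm : ℝ → Fin 3 → ℝ} (hp : Smooth3 I lp)
    (hm : Smooth3 I lm) : Smooth3 I (fieldNS lp lm) :=
  ContDiffOn.const_smul _ (ContDiffOn.sub hp hm)

theorem smooth3_fieldLtp {I : Set ℝ} {lp lm : ℝ → Fin 3 → ℝ} (hp : Smooth3 I lp)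
    (hm : Smooth3 I lm) : Smooth3 I (fieldLtp lp lm) :=
  ContDiffOn.add (smooth3_fieldNT hp hm) (smooth3_lcn hp hm)

theorem smooth3_fieldLtm {I : Set ℝ} {lp lm : ℝ → Fin 3 → ℝ} (hp : Smooth3 I lp)
    (hm : Smooth3 I lm) : Smooth3 I (fieldLtm lp lm) :=
  ContDiffOn.sub (smooth3_fieldNT hp hm) (smooth3_lcn hp hm)

theorem smooth1_mdot {I : Set ℝ} {x y : ℝ → Fin 3 → ℝ} (hx : Smooth3 I x)
    (hy : Smooth3 I y) : Smooth1 I fun t => mdot (x t) (y t) := by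
  have p := fun i => (contDiffOn_pi (𝕜 := ℝ)).1 hx i
  have m := fun i => (contDiffOn_pi (𝕜 := ℝ)).1 hy i
  exact (((p 0).mul (m 0)).neg.add ((p 1).mul (m 1))).add ((p 2).mul (m 2))

theorem hasDerivAt_of_contDiffOn {E : Type*} [NormedAddCommGroup E] [NormedSpace ℝ E]
    {I : Set ℝ} (hI : IsOpen I) {f : ℝ → E} (hf : ContDiffOn ℝ (⊤ : ℕ∞) f I) {t : ℝ}
    (ht : t ∈ I) : HasDerivAt f (deriv f t) t :=
  ((hf.differentiableOn (by simp)).differentiableAt (hI.mem_nhds ht)).hasDerivAt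

/-- The derivative of the translate `γ + λ ℓ̃⁻` of a lightcone framed curve along `ℓ̃⁻`. -/
theorem hasDerivAt_add_smul_fieldLtm {I : Set ℝ} (hI : IsOpen I)
    {γ lp lm : ℝ → Fin 3 → ℝ} {κ₁ κ₂ κ₃ α β : ℝ → ℝ}
    (hF : IsLightconeFramedCurve I γ lp lm)
    (hC : HasLightconeCurvature I γ lp lm κ₁ κ₂ κ₃ α β)
    {lam : ℝ → ℝ} (hlam : Smooth1 I lam) {t : ℝ} (ht : t ∈ I) :
    HasDerivAt (fun s => γ s + lam s • fieldLtm lp lm s)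
      ((α t + β t) • fieldNT lp lm t +
        (α t - β t + lam t * (κ₁ t - κ₂ t + κ₃ t)) • fieldNS lp lm t +
        (deriv lam t - lam t * (κ₂ t + κ₃ t)) • fieldLtm lp lm t) t := by
  have hγ := hasDerivAt_of_contDiffOn hI hF.smooth_base ht
  have hp := hasDerivAt_of_contDiffOn hI hF.smooth_lp ht
  have hm := hasDerivAt_of_contDiffOn hI hF.smooth_lm ht
  have hn := hasDerivAt_of_contDiffOn hI (smooth3_lcn hF.smooth_lp hF.smooth_lm) ht
  have hl := hasDerivAt_of_contDiffOn hI hlam ht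
  rw [hC.deriv_base t ht] at hγ
  rw [hC.deriv_lp t ht] at hp
  rw [hC.deriv_lm t ht] at hm
  rw [hC.deriv_n t ht] at hn
  have hv := ((hp.add hm).const_smul (1 / 2 : ℝ)).sub hn
  refine (hγ.add (hl.smul hv)).congr_deriv ?_
  ext i
  simp only [fieldLtm, fieldNT, fieldNS, fieldN, Pi.add_apply, Pi.sub_apply, Pi.smul_apply,
    smul_eq_mul]
  ring

theorem IsLightconeFramedCurve.swap {I : Set ℝ} {γ lp lm : ℝ → Fin 3 → ℝ}
    (h : IsLightconeFramedCurve I γ lp lm) : IsLightconeFramedCurve I γ lm lp := by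
  obtain ⟨α, β, hα, hβ, hd⟩ := h.exists_coeffs
  exact ⟨h.smooth_base, h.smooth_lm, h.smooth_lp, fun t ht => (h.delta4 t ht).symm,
    β, α, hβ, hα, fun t ht => by rw [hd t ht, add_comm]⟩

/-- Interchanging `ℓ̄⁺` and `ℓ̄⁻` turns `(v, ℓ̄⁺)`-mates into `(v, ℓ̄⁻)`-mates. -/
theorem isBertrand_fieldLp_iff_fieldLm {I : Set ℝ}
    {v : (ℝ → Fin 3 → ℝ) → (ℝ → Fin 3 → ℝ) → ℝ → Fin 3 → ℝ} {γ lp lm : ℝ → Fin 3 → ℝ} :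
    IsBertrand I v fieldLp γ lp lm ↔ IsBertrand I v fieldLm γ lp lm := by
  constructor <;> rintro ⟨γ', lp', lm', hF, hF', h⟩ <;> exact ⟨γ', lm', lp', hF, hF'.swap, h⟩

/-- The curve condition is necessary, with `k = ⟨ℓ̄⁺, nˢ⟩ / 2`. -/
theorem exists_condition_of_isBertrand {I : Set ℝ} (hI : IsOpen I)
    {γ lp lm : ℝ → Fin 3 → ℝ} {κ₁ κ₂ κ₃ α β : ℝ → ℝ}
    (hF : IsLightconeFramedCurve I γ lp lm)
    (hC : HasLightconeCurvature I γ lp lm κ₁ κ₂ κ₃ α β)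
    (h : IsBertrand I fieldLtm fieldLm γ lp lm) :
    ∃ lam k : ℝ → ℝ, Smooth1 I lam ∧ Smooth1 I k ∧ NotIdentZero I lam ∧
      ∀ t ∈ I, k t * (α t + β t) - α t + β t - lam t * (κ₁ t - κ₂ t + κ₃ t) = 0 := by
  obtain ⟨γ', lp', lm', -, hF', lam, hlam, hne, hγ', hv⟩ := h
  obtain ⟨a, b, -, -, hd⟩ := hF'.exists_coeffs
  refine ⟨lam, fun t => (1 / 2) * mdot (lp' t) (fieldNS lp lm t), hlam,
    contDiffOn_const.mul (smooth1_mdot hF'.smooth_lp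
      (smooth3_fieldNS hF.smooth_lp hF.smooth_lm)), hne, fun t ht => ?_⟩
  have hD := (hasDerivAt_add_smul_fieldLtm hI hF hC hlam ht).congr_of_eventuallyEq
    (Filter.eventuallyEq_of_mem (hI.mem_nhds ht) hγ')
  have hE := hD.deriv.symm.trans (hd t ht)
  have hvt : lm' t = fieldLtm lp lm t := (hv t ht).symm
  have hd4 := (hF'.delta4 t ht).2.2
  rw [hvt] at hE hd4
  obtain ⟨g₁, g₂, g₃, g₄, g₅, g₆, g₇, g₈, g₉⟩ := mdot_frame (hF.delta4 t ht)
  have e₁ := congrArg (fun x => mdot x (fieldLtm lp lm t)) hE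
  have e₂ := congrArg (fun x => mdot x (fieldNS lp lm t)) hE
  simp only [mdot_add_left, mdot_smul_left, hd4] at e₁ e₂
  have v₁ : mdot (fieldNT lp lm t) (fieldLtm lp lm t) = -1 := by
    simp only [fieldNT, fieldLtm, fieldN, mdot_add_left, mdot_add_right, mdot_smul_left,
      mdot_smul_right, mdot_sub_right, g₁, g₂, g₃, g₄, g₅, g₆]
    norm_num
  have v₂ : mdot (fieldNS lp lm t) (fieldLtm lp lm t) = 0 := by
    simp only [fieldNS, fieldNT, fieldLtm, fieldN, mdot_sub_left, mdot_add_right,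
      mdot_smul_left, mdot_smul_right, mdot_sub_right, g₁, g₂, g₃, g₄, g₅, g₆]
    norm_num
  have v₃ : mdot (fieldLtm lp lm t) (fieldLtm lp lm t) = 0 := by
    simp only [fieldNT, fieldLtm, fieldN, mdot_add_left, mdot_sub_left, mdot_add_right,
      mdot_smul_left, mdot_smul_right, mdot_sub_right, g₁, g₂, g₃, g₄, g₅, g₆, g₇, g₈, g₉]
    norm_num
  have v₄ : mdot (fieldNT lp lm t) (fieldNS lp lm t) = 0 := by
    simp only [fieldNS, fieldNT, mdot_add_left, mdot_smul_left, mdot_smul_right,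
      mdot_sub_right, g₁, g₂, g₃, g₄]
    norm_num
  have v₅ : mdot (fieldNS lp lm t) (fieldNS lp lm t) = 1 := by
    simp only [fieldNS, mdot_sub_left, mdot_smul_left, mdot_smul_right, mdot_sub_right,
      g₁, g₂, g₃, g₄]
    norm_num
  rw [v₁, v₂, v₃] at e₁
  rw [v₄, v₅, mdot_comm (fieldLtm lp lm t), v₂] at e₂
  linear_combination -e₂ + (1 / 2) * mdot (lp' t) (fieldNS lp lm t) * -e₁

/-- The curve condition is sufficient, with `ℓ̄⁺ = ℓ̃⁺ + 2k nˢ + k² ℓ̃⁻`. -/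
theorem isBertrand_of_condition {I : Set ℝ} (hI : IsOpen I)
    {γ lp lm : ℝ → Fin 3 → ℝ} {κ₁ κ₂ κ₃ α β lam k : ℝ → ℝ}
    (hF : IsLightconeFramedCurve I γ lp lm)
    (hC : HasLightconeCurvature I γ lp lm κ₁ κ₂ κ₃ α β)
    (hlam : Smooth1 I lam) (hk : Smooth1 I k) (hne : NotIdentZero I lam)
    (h : ∀ t ∈ I, k t * (α t + β t) - α t + β t - lam t * (κ₁ t - κ₂ t + κ₃ t) = 0) :
    IsBertrand I fieldLtm fieldLm γ lp lm := by
  have hv := smooth3_fieldLtm hF.smooth_lp hF.smooth_lm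
  have hw := smooth3_fieldLtp hF.smooth_lp hF.smooth_lm
  have hs := smooth3_fieldNS hF.smooth_lp hF.smooth_lm
  refine ⟨fun t => γ t + lam t • fieldLtm lp lm t,
    fun t => fieldLtp lp lm t + (2 * k t) • fieldNS lp lm t + (k t ^ 2) • fieldLtm lp lm t,
    fieldLtm lp lm, hF, ⟨?_, ?_, hv, fun t ht => ?_, ?_⟩, lam, hlam, hne,
    fun _ _ => rfl, fun _ _ => rfl⟩
  · exact ContDiffOn.add hF.smooth_base (ContDiffOn.smul hlam hv)
  · exact (ContDiffOn.add hw (ContDiffOn.smul (contDiffOn_const.mul hk) hs)).add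
      (ContDiffOn.smul (ContDiffOn.pow hk 2) hv)
  · obtain ⟨g₁, g₂, g₃, g₄, g₅, g₆, g₇, g₈, g₉⟩ := mdot_frame (hF.delta4 t ht)
    apply memDelta4_of_mdot <;>
    · simp only [fieldLtm, fieldLtp, fieldNT, fieldNS, fieldN, mdot_add_left, mdot_add_right,
        mdot_sub_left, mdot_sub_right, mdot_smul_left, mdot_smul_right,
        g₁, g₂, g₃, g₄, g₅, g₆, g₇, g₈, g₉]
      ring
  · refine ⟨fun t => (1 / 2) * (α t + β t),
      fun t => (1 / 2) * (α t + β t) * (1 - k t ^ 2) +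
        (deriv lam t - lam t * (κ₂ t + κ₃ t)), ?_, ?_, fun t ht => ?_⟩
    · exact contDiffOn_const.mul (ContDiffOn.add hC.smooth_α hC.smooth_β)
    · exact ((contDiffOn_const.mul (ContDiffOn.add hC.smooth_α hC.smooth_β)).mul
        (contDiffOn_const.sub (ContDiffOn.pow hk 2))).add
        ((ContDiffOn.deriv_of_isOpen hlam hI (by simp)).sub
          (ContDiffOn.mul hlam (ContDiffOn.add hC.smooth_κ₂ hC.smooth_κ₃)))
    · rw [(hasDerivAt_add_smul_fieldLtm hI hF hC hlam ht).deriv]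
      ext i
      simp only [fieldLtm, fieldLtp, fieldNT, fieldNS, fieldN, Pi.add_apply, Pi.sub_apply,
        Pi.smul_apply, smul_eq_mul]
      linear_combination -(1 / 2) * (lp t i - lm t i) * h t ht

/-- `(ℓ̃⁻,ℓ̄⁻)`-Bertrand lightcone framed curves: existence condition, and equivalence with
the `(ℓ̃⁻,ℓ̄⁺)`-Bertrand condition. -/
theorem bertrand_ltm_lmbar
    (I : Set ℝ) (hIo : IsOpen I) (hIc : I.OrdConnected)
    (γ lp lm : ℝ → Fin 3 → ℝ) (κ₁ κ₂ κ₃ α β : ℝ → ℝ)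
    (hF : IsLightconeFramedCurve I γ lp lm)
    (hC : HasLightconeCurvature I γ lp lm κ₁ κ₂ κ₃ α β) :
    (IsBertrand I fieldLtm fieldLm γ lp lm ↔
      ∃ lam k : ℝ → ℝ, Smooth1 I lam ∧ Smooth1 I k ∧ NotIdentZero I lam ∧
        ∀ t ∈ I, k t * (α t + β t) - α t + β t -
          lam t * (κ₁ t - κ₂ t + κ₃ t) = 0) ∧
    (IsBertrand I fieldLtm fieldLp γ lp lm ↔ IsBertrand I fieldLtm fieldLm γ lp lm) := by
  exact ⟨⟨exists_condition_of_isBertrand hIo hF hC, fun ⟨_, _, hlam, hk, hne, h⟩ =>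
    isBertrand_of_condition hIo hF hC hlam hk hne h⟩, isBertrand_fieldLp_iff_fieldLm⟩
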